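/- arXiv:math/0702679 — 4 statements merged into one kernel-verified Lean document; each statement's English description precedes it below -/
import Mathlib

section
/- Let λ ∈ 𝔽_q with λ ≠ 0 and n ≥ 2. Then the number N_q(λ) of points on the fibre satisfies N_q(λ) = ((q−1)^n − (−1)^n)/q + (−1)^n/(q−1) + ((−1)^n/(q(q−1))) · ∑ G_q(a)^{n+1} G_q(b) ω(−λ)^b, where the sum runs over all pairs of integers (a,b) with 0 ≤ a,b ≤ q−2, (a,b) ≠ (0,0), and (q−1) divides (n+1)a + b. -/
open Finset

lemma AddChar.map_sum_eq_prod {ι A M : Type*} [AddCommMonoid A] [CommMonoid M] (ψ : AddChar A M)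
    (s : Finset ι) (f : ι → A) : ψ (∑ i ∈ s, f i) = ∏ i ∈ s, ψ (f i) :=
  map_prod ψ.toMonoidHom (fun i => Multiplicative.ofAdd (f i)) s

lemma Fintype.sum_eq_add_sum_units {F M : Type*} [Field F] [Fintype F] [DecidableEq F]
    [AddCommMonoid M] (f : F → M) : ∑ a, f a = f 0 + ∑ u : Fˣ, f u := by
  rw [Fintype.sum_eq_add_sum_subtype_ne f 0, ← unitsEquivNeZero.sum_comp]
  rfl

section MulChar

variable {F : Type} [Field F] [Fintype F] [DecidableEq F] {ω : Fˣ →* ℂˣ}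

lemma injective_of_orderOf_eq_card_units (hω : orderOf ω = Fintype.card Fˣ) :
    Function.Injective ω := by
  obtain ⟨g, hg⟩ := IsCyclic.exists_generator (α := Fˣ)
  refine (injective_iff_map_eq_one ω).mpr fun u hu => ?_
  obtain ⟨j, rfl⟩ := Subgroup.mem_zpowers_iff.mp (hg u)
  have h_pow : ω ^ j = 1 := by
    ext v
    obtain ⟨i, rfl⟩ := Subgroup.mem_zpowers_iff.mp (hg v)
    have : (ω ^ j) (g ^ i) = 1 := by
      rw [map_zpow] at hu
      change ω (g ^ i) ^ j = 1
      rw [map_zpow, zpow_comm, hu, one_zpow]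
    simp [this]
  have h_dvd := (orderOf_dvd_iff_zpow_eq_one (x := ω)).mpr h_pow
  rw [hω, ← Nat.card_eq_fintype_card, ← orderOf_eq_card_of_forall_mem_zpowers hg] at h_dvd
  exact orderOf_dvd_iff_zpow_eq_one.mp h_dvd

lemma sum_range_pow_apply_eq_ite (hω : orderOf ω = Fintype.card Fˣ) (u : Fˣ) :
    ∑ k ∈ range (Fintype.card Fˣ), (ω u : ℂ) ^ k = if u = 1 then (Fintype.card Fˣ : ℂ) else 0 := by
  split_ifs with h
  · simp [h]
  · have h_ne : (ω u : ℂ) ≠ 1 := fun h1 => h <| injective_of_orderOf_eq_card_units hω <| by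
      rw [map_one]; exact Units.ext h1
    have h_pow : (ω u : ℂ) ^ Fintype.card Fˣ = 1 := by
      rw [← Units.val_pow_eq_pow_val, ← map_pow, pow_card_eq_one, map_one, Units.val_one]
    rw [geom_sum_eq h_ne, h_pow, sub_self, zero_div]

lemma sum_units_apply_pow_eq_ite (hω : orderOf ω = Fintype.card Fˣ) (m : ℕ) :
    ∑ z : Fˣ, (ω z : ℂ) ^ m =
      if Fintype.card Fˣ ∣ m then (Fintype.card Fˣ : ℂ) else 0 := by
  classical
  have h := sum_hom_units ((Units.coeHom ℂ).comp (ω ^ m))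
  have h_iff : (Units.coeHom ℂ).comp (ω ^ m) = 1 ↔ Fintype.card Fˣ ∣ m := by
    rw [← hω, orderOf_dvd_iff_pow_eq_one]
    constructor
    · intro h1
      ext z
      simpa using DFunLike.congr_fun h1 z
    · intro h1
      ext z
      simp [h1]
  simpa [h_iff] using h

/-- Fourier inversion on `Fˣ`. -/
lemma sum_range_fourier_mul_pow (hω : orderOf ω = Fintype.card Fˣ) (h : Fˣ → ℂ) (w : Fˣ) :
    ∑ k ∈ range (Fintype.card Fˣ), (∑ a, ((ω a : ℂ) ^ k)⁻¹ * h a) * (ω w : ℂ) ^ k =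
      Fintype.card Fˣ * h w := by
  have h_term (a : Fˣ) : ∑ k ∈ range (Fintype.card Fˣ), ((ω a : ℂ) ^ k)⁻¹ * h a * (ω w : ℂ) ^ k =
      if a = w then Fintype.card Fˣ * h w else 0 := by
    have h_eq := sum_range_pow_apply_eq_ite hω (w * a⁻¹)
    simp only [mul_inv_eq_one, eq_comm (a := w)] at h_eq
    calc _ = (∑ k ∈ range (Fintype.card Fˣ), (ω (w * a⁻¹) : ℂ) ^ k) * h a := by
          rw [sum_mul]
          refine sum_congr rfl fun k _ => ?_
          simp [mul_pow]
          ring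
      _ = _ := by
          rw [h_eq]
          split_ifs with haw <;> simp [haw]
  simp_rw [sum_mul]
  rw [sum_comm, sum_congr rfl fun a _ => h_term a]
  simp

lemma pow_sum_units_mul_addChar (ψ : AddChar F ℂ) (k m : ℕ) :
    (∑ a : Fˣ, ((ω a : ℂ) ^ k)⁻¹ * ψ a) ^ m =
      ∑ v : Fˣ, ((ω v : ℂ) ^ k)⁻¹ *
        ∑ y : Fin m → Fˣ, if ∏ i, y i = v then ψ (∑ i, (y i : F)) else 0 := by
  rw [sum_pow', Fintype.piFinset_univ]
  simp_rw [mul_sum]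
  rw [sum_comm]
  refine sum_congr rfl fun y _ => ?_
  simp only [mul_ite, mul_zero, sum_ite_eq, mem_univ, if_true]
  rw [prod_mul_distrib, map_prod, Units.coe_prod, ← prod_pow, prod_inv_distrib,
    AddChar.map_sum_eq_prod]

end MulChar

section PointCount

variable {F : Type} [Field F] [Fintype F] [DecidableEq F]

lemma sum_prod_eq_pow_addChar (ψ : AddChar F ℂ) (n : ℕ) (z : Fˣ) :
    (∑ y : Fin (n + 1) → Fˣ, if ∏ i, y i = z ^ (n + 1) then ψ (∑ i, (y i : F)) else 0) =
      ∑ x : Fin n → Fˣ, ψ (z * ((∑ i, (x i : F)) + (∏ i, (x i : F))⁻¹)) := by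
  rw [← (Fin.consEquiv fun _ => Fˣ).sum_comp, Fintype.sum_prod_type_right,
    ← Equiv.sum_comp (Equiv.mulLeft fun _ : Fin n => z)]
  refine sum_congr rfl fun x _ => ?_
  have h_iff (y : Fˣ) : y * (z ^ n * ∏ i, x i) = z ^ (n + 1) ↔ y = z * (∏ i, x i)⁻¹ := by
    rw [eq_mul_inv_iff_mul_eq, pow_succ', mul_comm (z ^ n), ← mul_assoc, mul_left_inj]
  simp only [Fin.consEquiv, Equiv.coe_fn_mk, Fin.prod_univ_succ, Fin.sum_univ_succ, Fin.cons_zero,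
    Fin.cons_succ, Equiv.coe_mulLeft, Pi.mul_apply, prod_mul_distrib, prod_const, card_univ,
    Fintype.card_fin, h_iff, sum_ite_eq', mem_univ, if_true, Units.val_mul, ← mul_sum]
  congr 1
  simp
  ring

lemma sum_units_addChar_eq_card_mul_sub {ψ : AddChar F ℂ} (hψ : ψ.IsPrimitive) (n : ℕ) (c : F) :
    ∑ z : Fˣ, ∑ x : Fin n → Fˣ,
        ψ (z * ((∑ i, (x i : F)) + (∏ i, (x i : F))⁻¹)) * ψ (-c * z) =
      Fintype.card F * Nat.card {x : Fin n → Fˣ //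
        (∑ i, (x i : F)) + (∏ i, (x i : F))⁻¹ = c} - (Fintype.card Fˣ : ℂ) ^ n := by
  have h_term (x : Fin n → Fˣ) :
      ∑ z : Fˣ, ψ (z * ((∑ i, (x i : F)) + (∏ i, (x i : F))⁻¹)) * ψ (-c * z) =
        (if (∑ i, (x i : F)) + (∏ i, (x i : F))⁻¹ = c then (Fintype.card F : ℂ) else 0) - 1 := by
    have h_sum := AddChar.sum_mulShift ((∑ i, (x i : F)) + (∏ i, (x i : F))⁻¹ - c) hψ
    rw [Fintype.sum_eq_add_sum_units] at h_sum
    simp only [zero_mul, AddChar.map_zero_eq_one, sub_eq_zero, Nat.cast_ite, Nat.cast_zero]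
      at h_sum
    rw [← h_sum, add_sub_cancel_left]
    refine sum_congr rfl fun z _ => ?_
    rw [← AddChar.map_add_eq_mul]
    congr 1
    ring
  rw [sum_comm, sum_congr rfl fun x _ => h_term x, sum_sub_distrib, ← sum_filter, sum_const,
    sum_const, Nat.card_eq_fintype_card, Fintype.card_subtype]
  simp [mul_comm]

end PointCount

section GaussSum

variable {F : Type} [Field F] [Fintype F] [DecidableEq F] {ω : Fˣ →* ℂˣ}

lemma sum_gauss_pow_mul_gauss (hω : orderOf ω = Fintype.card Fˣ) {ψ : AddChar F ℂ}
    (hψ : ψ.IsPrimitive) (g : ℕ → ℂ) (hg : ∀ k, g k = -∑ a : Fˣ, ((ω a : ℂ) ^ k)⁻¹ * ψ a)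
    (n : ℕ) (c : Fˣ) :
    ∑ ab ∈ (range (Fintype.card Fˣ) ×ˢ range (Fintype.card Fˣ)).filter
        (fun ab => Fintype.card Fˣ ∣ (n + 1) * ab.1 + ab.2),
      g ab.1 ^ (n + 1) * g ab.2 * (ω (-c) : ℂ) ^ ab.2 =
    (-1) ^ n * Fintype.card Fˣ * (Fintype.card F * Nat.card {x : Fin n → Fˣ //
        (∑ i, (x i : F)) + (∏ i, (x i : F))⁻¹ = c} - (Fintype.card Fˣ : ℂ) ^ n) := by
  have h_card : (Fintype.card Fˣ : ℂ) ≠ 0 := by simp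
  have h_fst (z : Fˣ) : ∑ a ∈ range (Fintype.card Fˣ),
      g a ^ (n + 1) * (ω (z ^ (n + 1)) : ℂ) ^ a = (-1) ^ (n + 1) * (Fintype.card Fˣ *
        ∑ x : Fin n → Fˣ, ψ (z * ((∑ i, (x i : F)) + (∏ i, (x i : F))⁻¹))) := by
    rw [← sum_prod_eq_pow_addChar, ← sum_range_fourier_mul_pow hω (fun v => ∑ y : Fin (n + 1) → Fˣ,
      if ∏ i, y i = v then ψ (∑ i, (y i : F)) else 0), mul_sum]
    refine sum_congr rfl fun a _ => ?_
    rw [hg, neg_pow, pow_sum_units_mul_addChar, mul_assoc]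
  have h_snd (z : Fˣ) : ∑ b ∈ range (Fintype.card Fˣ), g b * (ω (-c * z) : ℂ) ^ b =
      -(Fintype.card Fˣ * ψ (-c * z)) := by
    have h := sum_range_fourier_mul_pow hω (fun v => ψ v) (-c * z)
    simp only [Units.val_mul, Units.val_neg] at h
    rw [← h, ← sum_neg_distrib]
    refine sum_congr rfl fun b _ => ?_
    rw [hg, neg_mul]
  rw [← sum_units_addChar_eq_card_mul_sub hψ, ← mul_right_inj' h_card]
  calc _ = ∑ ab ∈ range (Fintype.card Fˣ) ×ˢ range (Fintype.card Fˣ),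
        g ab.1 ^ (n + 1) * g ab.2 * (ω (-c) : ℂ) ^ ab.2 *
          ∑ z : Fˣ, (ω z : ℂ) ^ ((n + 1) * ab.1 + ab.2) := by
        rw [sum_filter, mul_sum]
        refine sum_congr rfl fun ab _ => ?_
        rw [sum_units_apply_pow_eq_ite hω]
        split_ifs <;> ring
    _ = ∑ z : Fˣ, (∑ a ∈ range (Fintype.card Fˣ), g a ^ (n + 1) * (ω (z ^ (n + 1)) : ℂ) ^ a) *
          ∑ b ∈ range (Fintype.card Fˣ), g b * (ω (-c * z) : ℂ) ^ b := by
        rw [sum_congr rfl fun ab _ => mul_sum _ _ _, sum_comm]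
        refine sum_congr rfl fun z _ => ?_
        rw [sum_mul_sum, ← sum_product']
        refine sum_congr rfl fun ab _ => ?_
        simp only [map_mul, map_pow, Units.val_mul, Units.val_pow_eq_pow_val, mul_pow, pow_add,
          pow_mul]
        ring
    _ = _ := by
        simp_rw [h_fst, h_snd, ← sum_mul]
        rw [mul_sum, mul_sum]
        refine sum_congr rfl fun z _ => ?_
        ring

end GaussSum

/-- The canonical additive character of a finite field of characteristic `p`. -/
noncomputable def traceAddChar (p : ℕ) [NeZero p] (F : Type) [Field F] [Algebra (ZMod p) F] :
    AddChar F ℂ :=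
  (ZMod.stdAddChar (N := p)).compAddMonoidHom (Algebra.trace (ZMod p) F).toAddMonoidHom

lemma traceAddChar_apply (p : ℕ) [NeZero p] (F : Type) [Field F] [Algebra (ZMod p) F] (a : F) :
    traceAddChar p F a =
      Complex.exp (2 * Real.pi * Complex.I * ((Algebra.trace (ZMod p) F a).val : ℂ) / p) := by
  have h := ZMod.stdAddChar_coe (N := p) ((Algebra.trace (ZMod p) F a).val : ℤ)
  simp only [Int.cast_natCast, ZMod.natCast_zmod_val] at h
  exact h

lemma isPrimitive_traceAddChar (p : ℕ) [Fact p.Prime] (F : Type) [Field F] [Finite F]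
    [Algebra (ZMod p) F] : (traceAddChar p F).IsPrimitive := by
  refine AddChar.IsPrimitive.of_ne_one fun h => ?_
  obtain ⟨a, ha⟩ := Algebra.trace_surjective (ZMod p) F 1
  have h_val : ZMod.stdAddChar (Algebra.trace (ZMod p) F a) = 1 := DFunLike.congr_fun h a
  rw [ha, ← (ZMod.stdAddChar (N := p)).map_zero_eq_one] at h_val
  exact one_ne_zero (ZMod.injective_stdAddChar h_val)

theorem dwork_family_point_count_gauss_sums
    (p : ℕ) (hp : p.Prime) (F : Type) [Field F] [Fintype F] [DecidableEq F] [Algebra (ZMod p) F]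
    (q : ℕ) (hq : Fintype.card F = q)
    -- ω : a multiplicative character of 𝔽_q^* of order q − 1
    (ω : Fˣ →* ℂˣ) (hω : orderOf ω = q - 1)
    -- ψ : the canonical additive character a ↦ exp(2πi·Tr(a)/p)
    (ψ : F → ℂ)
    (hψ : ∀ a : F, ψ a =
      Complex.exp (2 * Real.pi * Complex.I * ((Algebra.trace (ZMod p) F a).val : ℂ) / p))
    -- the Gauss sums G_q(k)
    (G : ℤ → ℂ)
    (hG : ∀ k : ℤ, G k = -∑ a : Fˣ, ((ω a : ℂ) ^ (-k)) * ψ (a : F))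
    (n : ℕ) (hn : 2 ≤ n)
    (lam : F) (hlam : lam ≠ 0)
    -- N : the number of points (x₁,…,xₙ) ∈ (𝔽_q^*)^n with ∑ xᵢ + 1/∏ xᵢ = λ
    (N : ℕ)
    (hN : N = Nat.card {x : Fin n → Fˣ //
        (∑ i, (x i : F)) + (∏ i, (x i : F))⁻¹ = lam}) :
    (N : ℂ) = (((q : ℂ) - 1) ^ n - (-1) ^ n) / q + (-1) ^ n / ((q : ℂ) - 1)
      + (-1) ^ n / ((q : ℂ) * ((q : ℂ) - 1)) *
        ∑ ab ∈ (Finset.range (q - 1) ×ˢ Finset.range (q - 1)).filter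
            (fun ab => ab ≠ (0, 0) ∧ (q - 1) ∣ ((n + 1) * ab.1 + ab.2)),
          G ab.1 ^ (n + 1) * G ab.2 *
            ((ω (Units.mk0 (-lam) (neg_ne_zero.mpr hlam)) : ℂ)) ^ ab.2 := by
  have : Fact p.Prime := ⟨hp⟩
  obtain rfl : ψ = traceAddChar p F := funext fun a => by rw [hψ, traceAddChar_apply]
  have h_prim := isPrimitive_traceAddChar p F
  have h_units : q - 1 = Fintype.card Fˣ := by rw [Fintype.card_units, hq]
  have h_q : 1 < q := hq ▸ Fintype.one_lt_card
  have h_sub : (q : ℂ) - 1 = Fintype.card Fˣ := by rw [← h_units, Nat.cast_pred (by omega)]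
  have h_zero : G (0 : ℕ) = 1 := by
    have h_sum := AddChar.sum_mulShift (1 : F) h_prim
    rw [Fintype.sum_eq_add_sum_units] at h_sum
    rw [hG, neg_eq_iff_eq_neg, eq_neg_iff_add_eq_zero, add_comm]
    simpa using h_sum
  have h_main := sum_gauss_pow_mul_gauss (hω.trans h_units) h_prim (fun k => G k)
    (fun k => by simp [hG]) n (Units.mk0 lam hlam)
  have h_neg : Units.mk0 (-lam) (neg_ne_zero.mpr hlam) = -Units.mk0 lam hlam := Units.ext rfl
  rw [← h_units, hq, Units.val_mk0, ← hN, h_units, ← h_sub,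
    ← add_sum_erase _ _ (show ((0, 0) : ℕ × ℕ) ∈ _ by simp [Fintype.card_pos])] at h_main
  have h_filter : ((range (Fintype.card Fˣ) ×ˢ range (Fintype.card Fˣ)).filter
      (fun ab => Fintype.card Fˣ ∣ (n + 1) * ab.1 + ab.2)).erase (0, 0) =
      (range (Fintype.card Fˣ) ×ˢ range (Fintype.card Fˣ)).filter
      (fun ab => ab ≠ (0, 0) ∧ Fintype.card Fˣ ∣ (n + 1) * ab.1 + ab.2) := by
    ext ab
    simp only [mem_erase, mem_filter]
    tauto
  rw [h_filter] at h_main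
  rw [h_units, h_neg]
  simp only [h_zero, one_pow, pow_zero, mul_one] at h_main
  rw [← eq_sub_iff_add_eq'] at h_main
  rw [h_main]
  have h_q0 : (q : ℂ) ≠ 0 := by exact_mod_cast (by omega : q ≠ 0)
  have h_q1 : (q : ℂ) - 1 ≠ 0 := by rw [h_sub]; simp
  have h_sign : ((-1 : ℂ) ^ n) * (-1) ^ n = 1 := by rw [← mul_pow]; simp
  field_simp
  linear_combination ((1 - (q : ℂ)) * (q * N - ((q : ℂ) - 1) ^ n)) * h_sign
end

section
/- For n ≥ 2, the number of points in the fibre over λ = 0 satisfies N_q(0) = ((q−1)^n − (−1)^n)/q + ((−1)^{n+1}/q) · ∑ G_q(k)^{n+1}, where the sum runs over all integers k with 1 ≤ k ≤ q−2 such that (q−1) divides (n+1)k. -/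
/-!
STATEMENT 2: For n ≥ 2, the number of points in the fibre over λ = 0 satisfies
N_q(0) = ((q−1)^n − (−1)^n)/q + ((−1)^{n+1}/q) · ∑_{1 ≤ k ≤ q−2, (q−1) ∣ (n+1)k} G_q(k)^{n+1}.
-/

open Finset

section CyclicGroup

variable {A : Type*} [CommGroup A] [Fintype A]

lemma eq_one_of_apply_eq_one_of_orderOf_eq_card [IsCyclic A] {ω : A →* ℂˣ}
    (hω : orderOf ω = Fintype.card A) {a : A} (ha : ω a = 1) : a = 1 := by
  obtain ⟨g, hg⟩ := IsCyclic.exists_generator (α := A)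
  obtain ⟨j, rfl⟩ := Subgroup.mem_zpowers_iff.1 (hg a)
  have hdvd : Fintype.card A ∣ orderOf (ω g) := by
    rw [← hω, orderOf_dvd_iff_pow_eq_one]
    ext b
    obtain ⟨i, rfl⟩ := Subgroup.mem_zpowers_iff.1 (hg b)
    rw [MonoidHom.pow_apply, map_zpow, ← zpow_natCast, zpow_comm, zpow_natCast,
      pow_orderOf_eq_one, one_zpow, MonoidHom.one_apply]
  rw [map_zpow, ← orderOf_dvd_iff_zpow_eq_one] at ha
  rw [← orderOf_dvd_iff_zpow_eq_one]
  exact (Int.natCast_dvd_natCast.2 (orderOf_dvd_card.trans hdvd)).trans ha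

lemma sum_range_card_pow_apply [IsCyclic A] [DecidableEq A] {ω : A →* ℂˣ}
    (hω : orderOf ω = Fintype.card A) (a : A) :
    ∑ k ∈ range (Fintype.card A), (ω a : ℂ) ^ k = if a = 1 then (Fintype.card A : ℂ) else 0 := by
  split_ifs with ha
  · simp [ha]
  · have hne : (ω a : ℂ) ≠ 1 := fun h =>
      ha (eq_one_of_apply_eq_one_of_orderOf_eq_card hω (Units.ext h))
    rw [geom_sum_eq hne, ← Units.val_pow_eq_pow_val, ← map_pow, pow_card_eq_one]
    simp

lemma sum_apply_pow {ω : A →* ℂˣ} (hω : orderOf ω = Fintype.card A) (m : ℕ) :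
    ∑ a, (ω a : ℂ) ^ m = if Fintype.card A ∣ m then (Fintype.card A : ℂ) else 0 := by
  split_ifs with hm
  · rw [← hω, orderOf_dvd_iff_pow_eq_one] at hm
    have h (a : A) : (ω a : ℂ) ^ m = 1 := by
      rw [← Units.val_pow_eq_pow_val, ← MonoidHom.pow_apply, hm]
      simp
    simp [h]
  · have hne : (Units.coeHom ℂ).comp (ω ^ m) ≠ 1 := by
      intro h
      refine hm ?_
      rw [← hω, orderOf_dvd_iff_pow_eq_one]
      ext a
      simpa using DFunLike.congr_fun h a
    simpa using sum_hom_units_eq_zero _ hne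

lemma sum_prod_eq_sum_fiber [DecidableEq A] {n : ℕ} (f : A → ℂ) (c : A) :
    ∑ z : Fin (n + 1) → A, (if c * (∏ i, z i)⁻¹ = 1 then ∏ i, f (z i) else 0) =
      ∑ x : Fin n → A, f (c * (∏ i, x i)⁻¹) * ∏ i, f (x i) := by
  rw [← (Fin.consEquiv fun _ => A).sum_comp, Fintype.sum_prod_type, Finset.sum_comm]
  refine Finset.sum_congr rfl fun x _ => ?_
  rw [Finset.sum_eq_single (c * (∏ i, x i)⁻¹)]
  · simp [Fin.consEquiv, Fin.prod_univ_succ]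
  · intro b _ hb
    rw [if_neg]
    intro h
    refine hb ?_
    simp only [Fin.consEquiv, Equiv.coe_fn_mk, Fin.prod_univ_succ, Fin.cons_zero,
      Fin.cons_succ] at h
    rw [mul_inv_eq_one] at h
    rw [h, mul_inv_cancel_right]
  · simp

lemma card_mul_sum_fiber [IsCyclic A] [DecidableEq A] {ω : A →* ℂˣ}
    (hω : orderOf ω = Fintype.card A) {n : ℕ} (f : A → ℂ) (c : A) :
    (Fintype.card A : ℂ) * ∑ x : Fin n → A, f (c * (∏ i, x i)⁻¹) * ∏ i, f (x i) =
      ∑ k ∈ range (Fintype.card A),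
        (ω c : ℂ) ^ k * (∑ a, (ω a : ℂ) ^ (-(k : ℤ)) * f a) ^ (n + 1) := by
  rw [← sum_prod_eq_sum_fiber, Finset.mul_sum]
  simp_rw [Fintype.sum_pow, Finset.mul_sum]
  rw [Finset.sum_comm]
  refine Finset.sum_congr rfl fun z _ => ?_
  have h (k : ℕ) : (ω c : ℂ) ^ k * ∏ i, (ω (z i) : ℂ) ^ (-(k : ℤ)) * f (z i) =
      (ω (c * (∏ i, z i)⁻¹) : ℂ) ^ k * ∏ i, f (z i) := by
    rw [Finset.prod_mul_distrib, map_mul, map_inv, map_prod, Units.val_mul, mul_pow,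
      Units.val_inv_eq_inv_val, Units.coe_prod, inv_pow, ← Finset.prod_pow,
      ← Finset.prod_inv_distrib, mul_assoc]
    simp only [zpow_neg, zpow_natCast]
  simp_rw [h]
  rw [← Finset.sum_mul, sum_range_card_pow_apply hω]
  split_ifs <;> simp

end CyclicGroup

section FiniteField

variable {F : Type*} [Field F]

lemma AddChar.apply_sum_eq_prod {ι : Type*} (ψ : AddChar F ℂ) (s : Finset ι) (g : ι → F) :
    ψ (∑ i ∈ s, g i) = ∏ i ∈ s, ψ (g i) := by
  classical
  induction s using Finset.induction_on with
  | empty => simp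
  | insert a s ha ih => rw [Finset.sum_insert ha, Finset.prod_insert ha, map_add_eq_mul, ih]

variable [Fintype F]

lemma AddChar.IsPrimitive.sum_units [DecidableEq F] {ψ : AddChar F ℂ} (hψ : ψ.IsPrimitive) (b : F) :
    ∑ t : Fˣ, ψ (t * b) = (if b = 0 then (Fintype.card F : ℂ) else 0) - 1 := by
  have h := AddChar.sum_mulShift b hψ
  rw [← Fintype.sum_subtype_add_sum_subtype (fun x : F => x ≠ 0)] at h
  rw [← unitsEquivNeZero.sum_comp] at h
  have h0 : ∑ x : {x : F // ¬ x ≠ 0}, ψ (x * b) = 1 := by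
    rw [Fintype.sum_eq_single ⟨0, by simp⟩]
    · simp
    · rintro ⟨x, hx⟩ h'
      exact absurd (Subtype.ext (not_not.1 hx)) h'
  rw [h0] at h
  rw [eq_sub_iff_add_eq]
  simpa using h

lemma sum_addChar_mul_eq_sum_fiber [DecidableEq F] (ψ : AddChar F ℂ) (n : ℕ) (t : Fˣ) :
    ∑ x : Fin n → Fˣ, ψ (t * ((∑ i, (x i : F)) + (∏ i, (x i : F))⁻¹)) =
      ∑ x : Fin n → Fˣ,
        ψ (t ^ (n + 1) * (∏ i, x i)⁻¹ : Fˣ) * ∏ i, ψ (x i : F) := by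
  refine Fintype.sum_equiv (Equiv.piCongrRight fun _ => Equiv.mulLeft t) _ _ fun x => ?_
  rw [mul_add, AddChar.map_add_eq_mul, mul_comm, Finset.mul_sum, AddChar.apply_sum_eq_prod]
  simp only [Equiv.piCongrRight_apply, Pi.map_apply, Equiv.coe_mulLeft, Finset.prod_mul_distrib,
    Finset.prod_const, Finset.card_univ, Fintype.card_fin]
  push_cast
  congr 2
  have := t.ne_zero
  field_simp
  ring

lemma card_mul_card_zero_fiber [DecidableEq F] {ψ : AddChar F ℂ} (hψ : ψ.IsPrimitive) {ω : Fˣ →* ℂˣ}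
    (hω : orderOf ω = Fintype.card Fˣ) (n : ℕ) :
    (Fintype.card F : ℂ) * Nat.card {x : Fin n → Fˣ //
        (∑ i, (x i : F)) + (∏ i, (x i : F))⁻¹ = 0} =
      (Fintype.card Fˣ : ℂ) ^ n +
        ∑ k ∈ (range (Fintype.card Fˣ)).filter (fun k => Fintype.card Fˣ ∣ (n + 1) * k),
          (∑ a : Fˣ, (ω a : ℂ) ^ (-(k : ℤ)) * ψ (a : F)) ^ (n + 1) := by
  have hcount : (Fintype.card F : ℂ) * Nat.card {x : Fin n → Fˣ //
        (∑ i, (x i : F)) + (∏ i, (x i : F))⁻¹ = 0} = (Fintype.card Fˣ : ℂ) ^ n +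
        ∑ t : Fˣ, ∑ x : Fin n → Fˣ, ψ (t * ((∑ i, (x i : F)) + (∏ i, (x i : F))⁻¹)) := by
    rw [Finset.sum_comm]
    simp_rw [hψ.sum_units]
    rw [Finset.sum_sub_distrib, Nat.card_eq_fintype_card, Fintype.card_subtype,
      ← Finset.sum_filter]
    simp [mul_comm]
  rw [hcount, add_right_inj]
  have hcard : (Fintype.card Fˣ : ℂ) ≠ 0 := Nat.cast_ne_zero.2 Fintype.card_ne_zero
  refine mul_left_cancel₀ hcard ?_
  simp_rw [sum_addChar_mul_eq_sum_fiber]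
  rw [Finset.mul_sum]
  simp_rw [card_mul_sum_fiber hω (fun a : Fˣ => ψ (a : F))]
  rw [Finset.sum_comm, Finset.sum_filter, Finset.mul_sum]
  refine Finset.sum_congr rfl fun k _ => ?_
  simp_rw [map_pow, Units.val_pow_eq_pow_val, ← pow_mul]
  rw [← Finset.sum_mul, sum_apply_pow hω]
  split_ifs <;> simp

lemma exists_isPrimitive_eq_exp_trace {p : ℕ} (hp : p.Prime) [Algebra (ZMod p) F] :
    ∃ χ : AddChar F ℂ, χ.IsPrimitive ∧ ∀ a, χ a =
      Complex.exp (2 * Real.pi * Complex.I * ((Algebra.trace (ZMod p) F a).val : ℂ) / p) := by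
  have : Fact p.Prime := ⟨hp⟩
  refine ⟨ZMod.stdAddChar.compAddMonoidHom (Algebra.trace (ZMod p) F).toAddMonoidHom,
    AddChar.IsPrimitive.of_ne_one ?_, fun a => ?_⟩
  · obtain ⟨a, ha⟩ := Algebra.trace_surjective (ZMod p) F 1
    refine AddChar.ne_one_iff.2 ⟨a, fun h => ?_⟩
    have h' : ZMod.stdAddChar (Algebra.trace (ZMod p) F a) = ZMod.stdAddChar (0 : ZMod p) := by
      simpa using h
    rw [ZMod.injective_stdAddChar.eq_iff, ha] at h'
    exact one_ne_zero h'
  · exact ZMod.toCircle_apply _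

end FiniteField

theorem dwork_family_point_count_zero_fibre_gauss_sums
    (p : ℕ) (hp : p.Prime) (F : Type) [Field F] [Fintype F] [DecidableEq F]
    [Algebra (ZMod p) F]
    (q : ℕ) (hq : Fintype.card F = q)
    -- ω : a multiplicative character of 𝔽_q^* of order q − 1
    (ω : Fˣ →* ℂˣ) (hω : orderOf ω = q - 1)
    -- ψ : the canonical additive character a ↦ exp(2πi·Tr(a)/p)
    (ψ : F → ℂ)
    (hψ : ∀ a : F, ψ a =
      Complex.exp (2 * Real.pi * Complex.I * ((Algebra.trace (ZMod p) F a).val : ℂ) / p))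
    -- the Gauss sums G_q(k)
    (G : ℤ → ℂ)
    (hG : ∀ k : ℤ, G k = -∑ a : Fˣ, ((ω a : ℂ) ^ (-k)) * ψ (a : F))
    (n : ℕ) (hn : 2 ≤ n)
    -- N : the number of points (x₁,…,xₙ) ∈ (𝔽_q^*)^n with ∑ xᵢ + 1/∏ xᵢ = 0
    (N : ℕ)
    (hN : N = Nat.card {x : Fin n → Fˣ //
        (∑ i, (x i : F)) + (∏ i, (x i : F))⁻¹ = 0}) :
    (N : ℂ) = (((q : ℂ) - 1) ^ n - (-1) ^ n) / q
      + (-1) ^ (n + 1) / q *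
        ∑ k ∈ (Finset.Icc 1 (q - 2)).filter (fun k => (q - 1) ∣ (n + 1) * k),
          G k ^ (n + 1) := by
  obtain ⟨χ, hχ, hχψ⟩ := exists_isPrimitive_eq_exp_trace (F := F) hp
  obtain rfl : ψ = χ := funext fun a => (hψ a).trans (hχψ a).symm
  have hunits : Fintype.card Fˣ = q - 1 := by rw [Fintype.card_units, hq]
  have hq2 : 2 ≤ q := hq ▸ Fintype.one_lt_card
  have key := card_mul_card_zero_fiber hχ (hω.trans hunits.symm) n
  have hsum (k : ℤ) : ∑ a : Fˣ, (ω a : ℂ) ^ (-k) * χ (a : F) = -G k := by rw [hG, neg_neg]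
  have hG0 : G 0 = 1 := by
    have := hχ.sum_units 1
    simp at this
    simp [hG, this]
  have hrange : range (q - 1) = insert 0 (Icc 1 (q - 2)) := by
    ext k
    simp only [mem_range, mem_insert, mem_Icc]
    omega
  rw [← hN, hunits, hq, hrange, Finset.filter_insert, if_pos (by simp),
    Finset.sum_insert (by simp), Nat.cast_sub (by omega)] at key
  simp_rw [hsum] at key
  have hq0 : (q : ℂ) ≠ 0 := Nat.cast_ne_zero.2 (by omega)
  have hneg (k : ℤ) : (-G k) ^ (n + 1) = (-1) ^ (n + 1) * G k ^ (n + 1) := neg_pow _ _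
  simp_rw [hneg] at key
  rw [← Finset.mul_sum, Nat.cast_zero, hG0] at key
  refine mul_left_cancel₀ hq0 (key.trans ?_)
  field_simp
  push_cast
  ring
end

section
/- For every integer n ≥ 1, one has the identity in ℤ[x]: ∑_{b=0}^{n} (−1)^{b−1}·b·B_{n,b}(x) = ∏_{i=1}^{n−1} (1 − x^i). Equivalently, if β_b(k) denotes the coefficient of x^k z^b in the power series (1+z)(1+xz)⋯(1+x^{n−1}z) / ((1−x^2)(1−x^3)⋯(1−x^{n−1})), then ∑_{k≥0} (∑_{b=0}^{n} (−1)^{b−1} b β_b(k)) x^k = 1 − x. -/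
/-!
STATEMENT 13: For n ≥ 1, with B_{n,b}(x) ∈ ℤ[x] the coefficient of z^b in
∏_{i=0}^{n−1} (1 + x^i z), one has the identity in ℤ[x]:
∑_{b=0}^{n} (−1)^{b−1}·b·B_{n,b}(x) = ∏_{i=1}^{n−1} (1 − x^i).
(The sign (−1)^{b−1} is written (−1)^{b+1}, which agrees for all b ∈ ℤ.)
-/

open Finset Polynomial

/-- The alternating weighted sum of the coefficients of `p` is the derivative of `p` at `-1`. -/
theorem sum_neg_one_pow_mul_coeff_eq_eval_derivative {R : Type*} [CommRing R] (p : R[X]) (n : ℕ)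
    (hp : p.natDegree ≤ n) :
    ∑ b ∈ Finset.range (n + 1), (-1 : R) ^ (b + 1) * (b : R) * p.coeff b =
      p.derivative.eval (-1) := by
  rw [derivative_eval, p.sum_over_range' (by simp) (n + 1) (Nat.lt_succ_of_le hp)]
  refine Finset.sum_congr rfl fun b _ => ?_
  cases b with
  | zero => simp
  | succ k =>
    rw [Nat.add_sub_cancel]
    ring

/-- A product of `n` polynomials of degree at most one has degree at most `n`. -/
theorem natDegree_prod_one_add_C_mul_X_le {R : Type*} [CommRing R] (a : ℕ → R) (n : ℕ) :
    (∏ i ∈ Finset.range n, (1 + C (a i) * X)).natDegree ≤ n := by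
  refine (natDegree_prod_le _ _).trans ?_
  refine (Finset.sum_le_card_nsmul _ _ 1 fun i _ => ?_).trans (by simp)
  compute_degree

theorem alternating_weighted_sum_subset_gf
    (n : ℕ) (hn : 1 ≤ n) :
    ∑ b ∈ Finset.range (n + 1),
        (-1 : Polynomial ℤ) ^ (b + 1) * (b : Polynomial ℤ) *
          ((∏ i ∈ Finset.range n,
              (1 + Polynomial.C ((Polynomial.X : Polynomial ℤ) ^ i) * Polynomial.X)).coeff b)
      = ∏ i ∈ Finset.Icc 1 (n - 1), (1 - (Polynomial.X : Polynomial ℤ) ^ i) := by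
  rw [sum_neg_one_pow_mul_coeff_eq_eval_derivative _ n (natDegree_prod_one_add_C_mul_X_le _ n)]
  obtain ⟨m, rfl⟩ := Nat.exists_eq_add_of_le' hn
  rw [Finset.prod_range_succ', derivative_mul, eval_add, eval_mul, eval_mul, eval_prod,
    Nat.add_sub_cancel, ← Finset.Ico_add_one_right_eq_Icc, Finset.prod_Ico_eq_prod_range]
  simp [add_comm, sub_eq_add_neg]
end

section
/- Let q be a positive real number, w a positive integer, r a natural number, and α_1,…,α_r ∈ ℂ nonzero complex numbers such that the map α ↦ q^w/α permutes the multiset {α_1,…,α_r} (i.e. there is a permutation σ of {1,…,r} with α_{σ(i)} = q^w/α_i for all i). Let P(T) = ∏_{i=1}^r (1 − α_i T). Then there exists ε ∈ {1,−1} such that for all nonzero t ∈ ℂ, P(t) = ε·t^r·(√q)^{wr}·P(1/(q^w t)). -/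
/-!
STATEMENT 14: Let q > 0 real, w ≥ 1, and α₁,…,α_r nonzero complex numbers permuted by
α ↦ q^w/α.  Then P(T) = ∏ (1 − αᵢT) satisfies the functional equation
P(t) = ε·t^r·(√q)^{wr}·P(1/(q^w t)) for all t ≠ 0, for some sign ε ∈ {1,−1}.
-/

open Finset

theorem functional_equation_of_reciprocal_roots_permuted
    (q : ℝ) (hq : 0 < q) (w : ℕ) (hw : 1 ≤ w) (r : ℕ)
    (α : Fin r → ℂ) (hα : ∀ i, α i ≠ 0)
    (σ : Equiv.Perm (Fin r)) (hσ : ∀ i, α (σ i) = (q : ℂ) ^ w / α i) :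
    ∃ ε : ℂ, (ε = 1 ∨ ε = -1) ∧ ∀ t : ℂ, t ≠ 0 →
      ∏ i, (1 - α i * t)
        = ε * t ^ r * ((Real.sqrt q : ℂ)) ^ (w * r) *
            ∏ i, (1 - α i * (1 / ((q : ℂ) ^ w * t))) := by
  set Q : ℂ := (q : ℂ) ^ w with hQ
  set s : ℂ := ((Real.sqrt q : ℂ)) ^ w with hs
  set A : ℂ := ∏ i, α i with hA
  have hQ0 : Q ≠ 0 := pow_ne_zero _ (by exact_mod_cast hq.ne')
  have hsQ : s ^ 2 = Q := by
    rw [hs, hQ, pow_right_comm, ← Complex.ofReal_pow, Real.sq_sqrt hq.le]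
  have hA0 : A ≠ 0 := Finset.prod_ne_zero_iff.mpr fun i _ => hα i
  have hAA : A ^ 2 = Q ^ r := by
    have h : A = Q ^ r / A := by
      conv_lhs => rw [hA, ← Equiv.prod_comp σ α]
      simp [hσ, Finset.prod_div_distrib, hA]
    rw [sq]
    exact (eq_div_iff hA0).mp h
  refine ⟨(-1) ^ r * s ^ r / A, ?_, fun t ht => ?_⟩
  · apply eq_or_eq_neg_of_sq_eq_sq
    rw [one_pow, div_pow, hAA, mul_pow, ← pow_mul, ← pow_mul, mul_comm r 2, pow_mul, pow_mul,
      hsQ, neg_one_sq, one_pow, one_mul, div_self (pow_ne_zero r hQ0)]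
  have hfactor : ∀ i, 1 - α (σ i) * t = -(Q * t) / α i * (1 - α i * (1 / (Q * t))) := by
    intro i
    have := hα i
    rw [hσ]
    field_simp
    ring
  rw [← Equiv.prod_comp σ fun i => 1 - α i * t, Finset.prod_congr rfl fun i _ => hfactor i,
    Finset.prod_mul_distrib, Finset.prod_div_distrib, Finset.prod_const, Finset.card_univ,
    Fintype.card_fin, pow_mul, ← hs, ← hA, ← hsQ]
  ring
end
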